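/- Let $\Gamma^*$ be the set of odd homeomorphisms $h:H\to H$ such that $I(h(u))\ge 0$ for every $u$ in the open unit ball of $H$, and define $c_m=\sup_{h\in\Gamma^*}\;\inf\{I(h(u)) : u\in E_{m-1}^{\perp},\ \|u\|_H=1\}$. Then there exists a constant $k>0$ such that $c_{m+1}\ge k\,d_m^2$ for every $m\ge 1$; consequently $c_m\to+\infty$ as $m\to\infty$. -/

import Mathlib

open MeasureTheory Filter Topology

namespace BorsukChain

/-- Chains modulo 2 on ordered tuples of points, a tuple being a list. -/
abbrev Chain (V : Type*) := List V →₀ ZMod 2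

variable {V : Type*}

noncomputable section

/-- The chain of a single tuple. -/
abbrev tuple (l : List V) : Chain V := Finsupp.single l 1

/-- The linear extension of a map defined on tuples. -/
abbrev extend {M : Type*} [AddCommGroup M] [Module (ZMod 2) M] (f : List V → M) :
    Chain V →ₗ[ZMod 2] M :=
  Finsupp.linearCombination (ZMod 2) f

lemma extend_tuple {M : Type*} [AddCommGroup M] [Module (ZMod 2) M] (f : List V → M)
    (l : List V) : extend f (tuple l) = f l := by
  simp [extend, tuple]

lemma chain_hom_ext {M : Type*} [AddCommGroup M] [Module (ZMod 2) M]
    {f g : Chain V →ₗ[ZMod 2] M} (h : ∀ l, f (tuple l) = g (tuple l)) : f = g := by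
  refine Finsupp.lhom_ext' fun l => ?_
  ext
  simpa using h l

lemma add_self_eq_zero_of_zmod_two {M : Type*} [AddCommGroup M] [Module (ZMod 2) M] (x : M) :
    x + x = 0 := by
  have h : ((1 : ZMod 2) + 1) • x = 0 := by
    rw [show (1 : ZMod 2) + 1 = 0 from by decide, zero_smul]
  simpa [add_smul] using h

/-- Prepending a vertex to every tuple. -/
def cons (x : V) : Chain V →ₗ[ZMod 2] Chain V := extend fun l => tuple (x :: l)

/-- Applying a map to every vertex. -/
def push (f : V → V) : Chain V →ₗ[ZMod 2] Chain V := extend fun l => tuple (l.map f)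

/-- The boundary of a tuple, in the augmented complex. -/
def bdTuple : List V → Chain V
  | [] => 0
  | x :: l => tuple l + cons x (bdTuple l)

/-- The boundary operator. -/
def bd : Chain V →ₗ[ZMod 2] Chain V := extend bdTuple

/-- The prism over a tuple, between its images under `f` and `g`. -/
def prismTuple (f g : V → V) : List V → Chain V
  | [] => 0
  | x :: l => tuple (f x :: g x :: l.map g) + cons (f x) (prismTuple f g l)

/-- The prism operator. -/
def prism (f g : V → V) : Chain V →ₗ[ZMod 2] Chain V := extend (prismTuple f g)

@[simp] lemma cons_tuple (x : V) (l : List V) : cons x (tuple l) = tuple (x :: l) :=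
  extend_tuple _ _

@[simp] lemma push_tuple (f : V → V) (l : List V) : push f (tuple l) = tuple (l.map f) :=
  extend_tuple _ _

@[simp] lemma bd_nil : bd (tuple ([] : List V)) = 0 := extend_tuple _ _

lemma bd_tuple (l : List V) : bd (tuple l) = bdTuple l := extend_tuple _ _

@[simp] lemma bd_cons_tuple (x : V) (l : List V) :
    bd (tuple (x :: l)) = tuple l + cons x (bd (tuple l)) := by
  rw [bd_tuple, bd_tuple, bdTuple]

lemma bd_cons (x : V) (c : Chain V) : bd (cons x c) = c + cons x (bd c) := by
  have : bd ∘ₗ cons x = LinearMap.id + cons x ∘ₗ bd := chain_hom_ext fun l => by simp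
  exact congrArg (fun f => f c) this

@[simp] lemma prism_nil (f g : V → V) : prism f g (tuple []) = 0 := extend_tuple _ _

lemma prism_tuple (f g : V → V) (l : List V) : prism f g (tuple l) = prismTuple f g l :=
  extend_tuple _ _

@[simp] lemma prism_cons_tuple (f g : V → V) (x : V) (l : List V) :
    prism f g (tuple (x :: l)) =
      tuple (f x :: g x :: l.map g) + cons (f x) (prism f g (tuple l)) := by
  rw [prism_tuple, prism_tuple, prismTuple]

lemma prism_cons (f g : V → V) (x : V) (c : Chain V) :
    prism f g (cons x c) = cons (f x) (cons (g x) (push g c)) + cons (f x) (prism f g c) := by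
  have : prism f g ∘ₗ cons x =
      cons (f x) ∘ₗ cons (g x) ∘ₗ push g + cons (f x) ∘ₗ prism f g :=
    chain_hom_ext fun l => by simp
  exact congrArg (fun f => f c) this

lemma push_cons (f : V → V) (x : V) (c : Chain V) :
    push f (cons x c) = cons (f x) (push f c) := by
  have : push f ∘ₗ cons x = cons (f x) ∘ₗ push f := chain_hom_ext fun l => by simp
  exact congrArg (fun f => f c) this

lemma bd_push (f : V → V) (c : Chain V) : bd (push f c) = push f (bd c) := by
  have : bd ∘ₗ push f = push f ∘ₗ bd := chain_hom_ext fun l => by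
    induction l with
    | nil => simp
    | cons x l ih =>
      simp only [LinearMap.comp_apply, push_tuple, List.map_cons, bd_cons_tuple, map_add,
        push_cons] at ih ⊢
      rw [ih]
  exact congrArg (fun f => f c) this

lemma bd_bd (c : Chain V) : bd (bd c) = 0 := by
  have : bd ∘ₗ bd = (0 : Chain V →ₗ[ZMod 2] Chain V) := chain_hom_ext fun l => by
    induction l with
    | nil => simp
    | cons x l ih =>
      simp only [LinearMap.comp_apply, bd_cons_tuple, map_add, bd_cons,
        LinearMap.zero_apply] at ih ⊢
      rw [ih, map_zero, add_zero, add_self_eq_zero_of_zmod_two]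
  exact congrArg (fun f => f c) this

lemma bd_prism (f g : V → V) (c : Chain V) :
    bd (prism f g c) = push f c + push g c + prism f g (bd c) := by
  have : bd ∘ₗ prism f g = push f + push g + prism f g ∘ₗ bd := chain_hom_ext fun l => by
    induction l with
    | nil => simp [add_self_eq_zero_of_zmod_two]
    | cons x l ih =>
      have hp := bd_push g (tuple l)
      simp only [LinearMap.comp_apply, LinearMap.add_apply, push_tuple, List.map_cons,
        bd_cons_tuple, prism_cons_tuple, map_add, bd_cons, prism_cons] at ih hp ⊢
      rw [ih, hp]
      simp only [map_add, cons_tuple]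
      have h := add_self_eq_zero_of_zmod_two (tuple (f x :: l.map g))
      rw [← sub_eq_zero]
      refine Eq.trans ?_ h
      abel
  exact congrArg (fun f => f c) this

/-- The cup product of the coboundaries of the 0-cochains in `S`. -/
def cup : List (V → ZMod 2) → List V → ZMod 2
  | [], [_] => 1
  | s :: S, x :: y :: l => (s x + s y) * cup S (y :: l)
  | _, _ => 0

/-- The cup product of `s` with `cup S`. -/
def preCup (s : V → ZMod 2) (S : List (V → ZMod 2)) : List V → ZMod 2
  | [] => 0
  | x :: l => s x * cup S (x :: l)

@[simp] lemma cup_nil (S : List (V → ZMod 2)) : cup S [] = 0 := by cases S <;> rfl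

@[simp] lemma cup_cons_singleton (s : V → ZMod 2) (S : List (V → ZMod 2)) (x : V) :
    cup (s :: S) [x] = 0 := rfl

@[simp] lemma cup_nil_cons_cons (x y : V) (l : List V) : cup [] (x :: y :: l) = 0 := rfl

@[simp] lemma cup_nil_singleton (x : V) : cup [] [x] = 1 := rfl

@[simp] lemma cup_cons_cons_cons (s : V → ZMod 2) (S : List (V → ZMod 2)) (x y : V) (l : List V) :
    cup (s :: S) (x :: y :: l) = (s x + s y) * cup S (y :: l) := rfl

lemma extend_cup_cons_cons (s : V → ZMod 2) (S : List (V → ZMod 2)) (x y : V) (c : Chain V) :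
    extend (cup (s :: S)) (cons x (cons y c)) = (s x + s y) * extend (cup S) (cons y c) := by
  have : extend (cup (s :: S)) ∘ₗ cons x ∘ₗ cons y = (s x + s y) • extend (cup S) ∘ₗ cons y :=
    chain_hom_ext fun l => by simp
  exact congrArg (fun f => f c) this

lemma extend_cup_nil_cons_cons (x y : V) (c : Chain V) :
    extend (cup []) (cons x (cons y c)) = 0 := by
  have : extend (cup []) ∘ₗ cons x ∘ₗ cons y = 0 :=
    chain_hom_ext fun l => by simp
  exact congrArg (fun f => f c) this

lemma extend_preCup_cons (s : V → ZMod 2) (S : List (V → ZMod 2)) (x : V) (c : Chain V) :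
    extend (preCup s S) (cons x c) = s x * extend (cup S) (cons x c) := by
  have : extend (preCup s S) ∘ₗ cons x = s x • extend (cup S) ∘ₗ cons x :=
    chain_hom_ext fun l => by simp [preCup]
  exact congrArg (fun f => f c) this

/-- Cup products of coboundaries are cocycles. -/
lemma extend_cup_bd (S : List (V → ZMod 2)) (c : Chain V) : extend (cup S) (bd c) = 0 := by
  have : extend (cup S) ∘ₗ bd = 0 := chain_hom_ext fun l => by
    induction S generalizing l with
    | nil =>
      match l with
      | [] => simp
      | [x] => simp
      | [x, y] => simp; decide
      | x :: y :: z :: l =>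
        simp [-Finsupp.linearCombination_single, extend_tuple, extend_cup_nil_cons_cons]
    | cons s S ih =>
      match l with
      | [] => simp
      | [x] => simp
      | [x, y] => simp
      | x :: y :: z :: l =>
        have h := ih (y :: z :: l)
        simp only [LinearMap.comp_apply, LinearMap.zero_apply, bd_cons_tuple, map_add,
          extend_cup_cons_cons, extend_tuple, cons_tuple, cup_cons_cons_cons] at h ⊢
        have h2 : (2 : ZMod 2) = 0 := by decide
        linear_combination (s x + s y) * h + (s z * cup S (z :: l)) * h2
  exact congrArg (fun f => f c) this

/-- `cup (s :: S)` is the coboundary of the cup product of `s` with `cup S`. -/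
lemma extend_preCup_bd (s : V → ZMod 2) (S : List (V → ZMod 2)) (c : Chain V) :
    extend (preCup s S) (bd c) = extend (cup (s :: S)) c := by
  have : extend (preCup s S) ∘ₗ bd = extend (cup (s :: S)) := chain_hom_ext fun l => by
    match l with
    | [] => simp
    | [x] => simp [preCup]
    | x :: y :: l =>
      have h := extend_cup_bd S (tuple (x :: y :: l))
      simp only [LinearMap.comp_apply, bd_cons_tuple, map_add, extend_tuple, cons_tuple,
        extend_preCup_cons, preCup, cup_cons_cons_cons] at h ⊢
      have h2 : (2 : ZMod 2) = 0 := by decide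
      linear_combination s x * h - (s x * cup S (y :: l)) * h2
  exact congrArg (fun f => f c) this


/-- The chains supported on a set of tuples. -/
abbrev chainsOn (Q : Set (List V)) : Submodule (ZMod 2) (Chain V) :=
  Finsupp.supported (ZMod 2) (ZMod 2) Q

lemma tuple_mem_chainsOn {Q : Set (List V)} {l : List V} (h : l ∈ Q) : tuple l ∈ chainsOn Q :=
  Finsupp.single_mem_supported _ _ h

lemma map_mem_of_mem_chainsOn {M : Type*} [AddCommGroup M] [Module (ZMod 2) M]
    {Q : Set (List V)} {W : Submodule (ZMod 2) M} (f : Chain V →ₗ[ZMod 2] M)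
    (h : ∀ l ∈ Q, f (tuple l) ∈ W) {c : Chain V} (hc : c ∈ chainsOn Q) : f c ∈ W := by
  rw [chainsOn, Finsupp.supported_eq_span_single] at hc
  refine (Submodule.span_le (p := W.comap f)).2 ?_ hc
  rintro _ ⟨l, hl, rfl⟩
  exact h l hl

lemma map_eq_map_of_mem_chainsOn {M : Type*} [AddCommGroup M] [Module (ZMod 2) M]
    {Q : Set (List V)} (f g : Chain V →ₗ[ZMod 2] M)
    (h : ∀ l ∈ Q, f (tuple l) = g (tuple l)) {c : Chain V} (hc : c ∈ chainsOn Q) :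
    f c = g c := by
  have := map_mem_of_mem_chainsOn (W := ⊥) (f - g)
    (fun l hl => by simp [-Finsupp.linearCombination_single, h l hl]) hc
  simpa [sub_eq_zero] using this

lemma cons_mem_chainsOn {Q Q' : Set (List V)} (x : V) (h : ∀ l ∈ Q, x :: l ∈ Q') {c : Chain V}
    (hc : c ∈ chainsOn Q) : cons x c ∈ chainsOn Q' :=
  map_mem_of_mem_chainsOn _
    (fun l hl => by rw [cons_tuple]; exact tuple_mem_chainsOn (h l hl)) hc

lemma push_mem_chainsOn {Q Q' : Set (List V)} (f : V → V) (h : ∀ l ∈ Q, l.map f ∈ Q')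
    {c : Chain V} (hc : c ∈ chainsOn Q) : push f c ∈ chainsOn Q' :=
  map_mem_of_mem_chainsOn _
    (fun l hl => by rw [push_tuple]; exact tuple_mem_chainsOn (h l hl)) hc

lemma bd_tuple_mem_chainsOn (l : List V) : bd (tuple l) ∈ chainsOn {l' | l' ⊆ l} := by
  induction l with
  | nil => rw [bd_nil]; exact zero_mem _
  | cons x l ih =>
    rw [bd_cons_tuple]
    refine add_mem (tuple_mem_chainsOn (List.subset_cons_self x l))
      (cons_mem_chainsOn x (fun l' hl' => ?_) ih)
    exact List.cons_subset_cons x hl'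

lemma prism_tuple_mem_chainsOn (f g : V → V) (l : List V) :
    prism f g (tuple l) ∈ chainsOn {l' | ∀ y ∈ l', ∃ x ∈ l, y = f x ∨ y = g x} := by
  induction l with
  | nil => rw [prism_nil]; exact zero_mem _
  | cons x l ih =>
    rw [prism_cons_tuple]
    refine add_mem (tuple_mem_chainsOn ?_) (cons_mem_chainsOn (f x) (fun l' hl' => ?_) ih)
    · intro y hy
      simp only [List.mem_cons, List.mem_map] at hy ⊢
      rcases hy with rfl | rfl | ⟨z, hz, rfl⟩
      · exact ⟨x, Or.inl rfl, Or.inl rfl⟩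
      · exact ⟨x, Or.inl rfl, Or.inr rfl⟩
      · exact ⟨z, Or.inr hz, Or.inr rfl⟩
    · intro y hy
      rcases List.mem_cons.1 hy with rfl | hy
      · exact ⟨x, List.mem_cons_self, Or.inl rfl⟩
      · obtain ⟨z, hz, h⟩ := hl' y hy
        exact ⟨z, List.mem_cons_of_mem _ hz, h⟩

lemma prism_mem_chainsOn {Q Q' : Set (List V)} (f g : V → V)
    (h : ∀ l ∈ Q, ∀ l', (∀ y ∈ l', ∃ x ∈ l, y = f x ∨ y = g x) → l' ∈ Q')
    {c : Chain V} (hc : c ∈ chainsOn Q) : prism f g c ∈ chainsOn Q' :=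
  map_mem_of_mem_chainsOn _ (fun l hl =>
    Finsupp.supported_mono (fun l' hl' => h l hl l' hl') (prism_tuple_mem_chainsOn f g l)) hc

open Classical in
/-- The part of a chain made of the tuples contained in `U`. -/
def restr (U : Set V) : Chain V →ₗ[ZMod 2] Chain V :=
  extend fun l => if ∀ x ∈ l, x ∈ U then tuple l else 0

lemma restr_tuple_of_forall {U : Set V} {l : List V} (h : ∀ x ∈ l, x ∈ U) :
    restr U (tuple l) = tuple l := by
  classical
  rw [restr, extend_tuple, if_pos h]

lemma restr_tuple_of_not_forall {U : Set V} {l : List V} (h : ¬ ∀ x ∈ l, x ∈ U) :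
    restr U (tuple l) = 0 := by
  classical
  rw [restr, extend_tuple, if_neg h]

/-- The tuples contained in `U` and all of whose points are close to one point outside `U`. -/
def nearTuples [PseudoMetricSpace V] (U : Set V) (ε : ℝ) : Set (List V) :=
  {l | (∀ x ∈ l, x ∈ U) ∧ ∃ y, y ∉ U ∧ ∀ x ∈ l, dist x y ≤ ε}

lemma restr_mem_nearTuples [PseudoMetricSpace V] {U : Set V} {ε : ℝ} {y : V} (hy : y ∉ U)
    {Q : Set (List V)} (hQ : ∀ l ∈ Q, ∀ x ∈ l, x ∉ U) {c : Chain V} (hc : c ∈ chainsOn Q) :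
    restr U c ∈ chainsOn (nearTuples U ε) := by
  refine map_mem_of_mem_chainsOn _ (fun l hl => ?_) hc
  match l, hl with
  | [], _ =>
    rw [restr_tuple_of_forall (by simp)]
    exact tuple_mem_chainsOn ⟨by simp, y, hy, by simp⟩
  | x :: l, hl =>
    rw [restr_tuple_of_not_forall fun h => hQ _ hl x (by simp) (h x (by simp))]
    exact zero_mem _

lemma bd_restr_add_restr_bd_mem [PseudoMetricSpace V] {U : Set V} {ε : ℝ} {Q : Set (List V)}
    (hQ : ∀ l ∈ Q, ∀ x ∈ l, ∀ y ∈ l, dist x y ≤ ε) {c : Chain V} (hc : c ∈ chainsOn Q) :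
    bd (restr U c) + restr U (bd c) ∈ chainsOn (nearTuples U ε) := by
  refine map_mem_of_mem_chainsOn (bd ∘ₗ restr U + restr U ∘ₗ bd) (fun l hl => ?_) hc
  simp only [LinearMap.add_apply, LinearMap.comp_apply]
  by_cases h : ∀ x ∈ l, x ∈ U
  · have : restr U (bd (tuple l)) = LinearMap.id (bd (tuple l)) :=
      map_eq_map_of_mem_chainsOn (Q := {l' | l' ⊆ l}) _ _ (fun l' hl' =>
        restr_tuple_of_forall fun x hx => h x (hl' hx)) (bd_tuple_mem_chainsOn l)
    rw [restr_tuple_of_forall h, this, LinearMap.id_apply, add_self_eq_zero_of_zmod_two]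
    exact zero_mem _
  · rw [restr_tuple_of_not_forall h, map_zero, zero_add]
    refine map_mem_of_mem_chainsOn _ (fun l' hl' => ?_) (bd_tuple_mem_chainsOn l)
    by_cases h' : ∀ x ∈ l', x ∈ U
    · rw [restr_tuple_of_forall h']
      push Not at h
      obtain ⟨y, hy, hyU⟩ := h
      exact tuple_mem_chainsOn ⟨h', y, hyU, fun x hx => hQ l hl x (hl' hx) y hy⟩
    · rw [restr_tuple_of_not_forall h']
      exact zero_mem _

lemma push_neg_restr [InvolutiveNeg V] {U : Set V} (hU : ∀ x, -x ∈ U ↔ x ∈ U) (c : Chain V) :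
    push Neg.neg (restr U c) = restr U (push Neg.neg c) := by
  have : push Neg.neg ∘ₗ restr U = restr U ∘ₗ push Neg.neg := chain_hom_ext fun l => by
    simp only [LinearMap.comp_apply, push_tuple]
    have hl : (∀ x ∈ l.map Neg.neg, x ∈ U) ↔ ∀ x ∈ l, x ∈ U := by
      rw [List.forall_mem_map]
      simp only [hU]
    by_cases h : ∀ x ∈ l, x ∈ U
    · rw [restr_tuple_of_forall h, restr_tuple_of_forall (hl.2 h), push_tuple]
    · rw [restr_tuple_of_not_forall h, restr_tuple_of_not_forall (mt hl.1 h), map_zero]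
  exact congrArg (fun f => f c) this

lemma push_neg_push_neg [InvolutiveNeg V] (c : Chain V) :
    push Neg.neg (push Neg.neg c) = c := by
  have : push Neg.neg ∘ₗ push Neg.neg = (LinearMap.id : Chain V →ₗ[ZMod 2] Chain V) :=
    chain_hom_ext fun l => by simp
  exact congrArg (fun f => f c) this

lemma cup_map_neg [InvolutiveNeg V] {S : List (V → ZMod 2)} {l : List V}
    (h : ∀ s ∈ S, ∀ x ∈ l, s (-x) = s x + 1) : cup S (l.map Neg.neg) = cup S l := by
  induction S generalizing l with
  | nil => match l with
    | [] => rfl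
    | [x] => rfl
    | x :: y :: l => rfl
  | cons s S ih => match l with
    | [] => rfl
    | [x] => rfl
    | x :: y :: l =>
      have h1 := ih (l := y :: l) fun s hs z hz =>
        h s (List.mem_cons_of_mem _ hs) z (List.mem_cons_of_mem _ hz)
      have hx := h s (by simp) x (by simp)
      have hy := h s (by simp) y (by simp)
      have h2 : (2 : ZMod 2) = 0 := by decide
      simp only [List.map_cons, cup_cons_cons_cons] at h1 ⊢
      rw [h1, hx, hy]
      linear_combination cup S (y :: l) * h2

lemma preCup_add_preCup_map_neg [InvolutiveNeg V] {s : V → ZMod 2} {S : List (V → ZMod 2)}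
    {l : List V} (hs : ∀ x ∈ l, s (-x) = s x + 1)
    (h : ∀ s ∈ S, ∀ x ∈ l, s (-x) = s x + 1) :
    preCup s S l + preCup s S (l.map Neg.neg) = cup S l := by
  match l with
  | [] => simp [preCup]
  | x :: l =>
    have h1 := cup_map_neg h
    have h2 : (2 : ZMod 2) = 0 := by decide
    simp only [List.map_cons, preCup] at h1 ⊢
    rw [h1, hs x (by simp)]
    linear_combination s x * cup S (x :: l) * h2

/-- A cup product having a factor which is constant on the vertices vanishes. -/
lemma cup_eq_zero {S : List (V → ZMod 2)} {l : List V} {s : V → ZMod 2} (hs : s ∈ S)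
    (h : ∀ x ∈ l, ∀ y ∈ l, s x = s y) : cup S l = 0 := by
  induction S generalizing l with
  | nil => simp at hs
  | cons t S ih => match l with
    | [] => rfl
    | [x] => rfl
    | x :: y :: l =>
      rw [cup_cons_cons_cons]
      rcases List.mem_cons.1 hs with rfl | hs
      · rw [h x (by simp) y (by simp), add_self_eq_zero_of_zmod_two, zero_mul]
      · rw [ih hs fun a ha b hb => h a (List.mem_cons_of_mem _ ha) b (List.mem_cons_of_mem _ hb),
          mul_zero]

/-- Passing from one dimension to the next leaves the evaluation of the cup product unchanged. -/
lemma extend_cup_cons_eq [InvolutiveNeg V] {U : Set V} (hU : ∀ x, -x ∈ U ↔ x ∈ U)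
    {s : V → ZMod 2} {S : List (V → ZMod 2)} {Q : Set (List V)}
    (hs : ∀ l ∈ Q, ∀ x ∈ l, s (-x) = s x + 1)
    (hS : ∀ l ∈ Q, ∀ t ∈ S, ∀ x ∈ l, t (-x) = t x + 1)
    {b b' κ κ' : Chain V} (hb : push Neg.neg b = b) (hb' : b' = κ + push Neg.neg κ)
    (hQ : bd (restr U κ) + restr U b ∈ chainsOn Q) :
    extend (cup (s :: S)) (bd (restr U κ') + restr U b') =
      extend (cup S) (bd (restr U κ) + restr U b) := by
  set c := bd (restr U κ) + restr U b with hc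
  have key : bd (bd (restr U κ') + restr U b') = c + push Neg.neg c := by
    rw [hb', hc]
    simp only [map_add, bd_bd, zero_add, ← push_neg_restr hU, bd_push]
    rw [push_neg_restr hU b, hb]
    have h := add_self_eq_zero_of_zmod_two (restr U b)
    rw [← sub_eq_zero, ← neg_eq_zero]
    refine Eq.trans ?_ h
    abel
  rw [← extend_preCup_bd, key]
  refine map_eq_map_of_mem_chainsOn
    (extend (preCup s S) ∘ₗ (LinearMap.id + push Neg.neg)) (extend (cup S)) (fun l hl => ?_) hQ
  simp only [LinearMap.comp_apply, LinearMap.add_apply, LinearMap.id_apply, push_tuple, map_add,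
    extend_tuple]
  exact preCup_add_preCup_map_neg (hs l hl) (hS l hl)

section Cylinder

variable [AddCommGroup V] [Module ℝ V]

/-- The cylinder over `b` in the direction `e`, made of `N` prisms of height `η`. -/
def cylinder (η : ℝ) (e : V) (N : ℕ) : Chain V →ₗ[ZMod 2] Chain V :=
  ∑ t ∈ Finset.range N, prism (· + ((t : ℝ) * η) • e) (· + ((t + 1 : ℝ) * η) • e)

lemma bd_cylinder (η : ℝ) (e : V) (N : ℕ) (b : Chain V) :
    bd (cylinder η e N b) = push (· + ((N : ℝ) * η) • e) b + b + cylinder η e N (bd b) := by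
  induction N with
  | zero =>
    have : push (· + (((0 : ℕ) : ℝ) * η) • e) b = b := by
      have : push (· + (((0 : ℕ) : ℝ) * η) • e) = (LinearMap.id : Chain V →ₗ[ZMod 2] Chain V) :=
        chain_hom_ext fun l => by simp
      exact congrArg (fun f => f b) this
    rw [this, add_self_eq_zero_of_zmod_two]
    simp [cylinder]
  | succ N ih =>
    have hstep : ∀ c, cylinder η e (N + 1) c = cylinder η e N c +
        prism (· + ((N : ℝ) * η) • e) (· + ((N + 1 : ℝ) * η) • e) c := fun c => by
      simp [cylinder, Finset.sum_range_succ]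
    rw [hstep, hstep, map_add, ih, bd_prism]
    have h := add_self_eq_zero_of_zmod_two (push (· + ((N : ℝ) * η) • e) b)
    push_cast
    rw [← sub_eq_zero]
    refine Eq.trans ?_ h
    abel

lemma cylinder_mem_chainsOn {Q Q' : Set (List V)} (η : ℝ) (e : V) (N : ℕ)
    (h : ∀ l ∈ Q, ∀ t : ℝ, ∀ l',
      (∀ y ∈ l', ∃ x ∈ l, y = x + (t * η) • e ∨ y = x + ((t + 1) * η) • e) → l' ∈ Q')
    {c : Chain V} (hc : c ∈ chainsOn Q) : cylinder η e N c ∈ chainsOn Q' := by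
  rw [cylinder, LinearMap.sum_apply]
  exact sum_mem fun t _ => prism_mem_chainsOn _ _ (fun l hl l' hl' => h l hl t l' hl') hc

end Cylinder


section Box

variable {d : ℕ}

/-- The `k`-th coordinate vector, which is zero if `k` is out of range. -/
def coordVec (d k : ℕ) : Fin d → ℝ := fun i => if (i : ℕ) = k then 1 else 0

/-- A chain filling the box of half-side `N * η` in the span of the first `k` coordinate
vectors. -/
def boxChain (d : ℕ) (η : ℝ) (N : ℕ) : ℕ → Chain (Fin d → ℝ)
  | 0 => tuple [0]
  | k + 1 => cylinder η (coordVec d k) N (boxChain d η N k) +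
      push Neg.neg (cylinder η (coordVec d k) N (boxChain d η N k))

/-- The upper half of the next `boxChain`. -/
def halfBoxChain (d : ℕ) (η : ℝ) (N k : ℕ) : Chain (Fin d → ℝ) :=
  cylinder η (coordVec d k) N (boxChain d η N k)

lemma boxChain_succ (η : ℝ) (N k : ℕ) : boxChain d η N (k + 1) =
    halfBoxChain d η N k + push Neg.neg (halfBoxChain d η N k) := rfl

lemma push_neg_boxChain (η : ℝ) (N k : ℕ) :
    push Neg.neg (boxChain d η N k) = boxChain d η N k := by
  cases k with
  | zero => rw [boxChain, push_tuple]; simp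
  | succ k => rw [boxChain_succ, map_add, push_neg_push_neg, add_comm]

/-- The tuples lying in the span of the first `k` coordinate vectors, with small diameter. -/
def flatTuples (d : ℕ) (η : ℝ) (k : ℕ) : Set (List (Fin d → ℝ)) :=
  {l | (∀ x ∈ l, ∀ i : Fin d, k ≤ i → x i = 0) ∧ ∀ x ∈ l, ∀ y ∈ l, dist x y ≤ k * η}

/-- The tuples all of whose vertices have one of their first `k` coordinates of size at
least `R`. -/
def outerTuples (d : ℕ) (R : ℝ) (k : ℕ) : Set (List (Fin d → ℝ)) :=
  {l | ∀ x ∈ l, ∃ i : Fin d, (i : ℕ) < k ∧ R ≤ |x i|}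

lemma map_neg_mem_flatTuples {η : ℝ} {k : ℕ} {l : List (Fin d → ℝ)}
    (hl : l ∈ flatTuples d η k) : l.map Neg.neg ∈ flatTuples d η k := by
  refine ⟨?_, ?_⟩
  · rw [List.forall_mem_map]
    intro x hx i hi
    simp [hl.1 x hx i hi]
  · simp only [List.forall_mem_map, dist_neg_neg]
    exact hl.2

lemma map_neg_mem_outerTuples {R : ℝ} {k : ℕ} {l : List (Fin d → ℝ)}
    (hl : l ∈ outerTuples d R k) : l.map Neg.neg ∈ outerTuples d R k := by
  change ∀ x ∈ l.map Neg.neg, _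
  simp only [List.forall_mem_map, Pi.neg_apply, abs_neg]
  exact hl

lemma halfBoxChain_mem_flatTuples_of {η : ℝ} (hη : 0 ≤ η) {N k : ℕ}
    (h : boxChain d η N k ∈ chainsOn (flatTuples d η k)) :
    halfBoxChain d η N k ∈ chainsOn (flatTuples d η (k + 1)) := by
  refine cylinder_mem_chainsOn _ _ _ (fun l hl t l' hl' => ?_) h
  refine ⟨?_, ?_⟩
  · intro y hy i hi
    obtain ⟨x, hx, h⟩ := hl' y hy
    have hxi := hl.1 x hx i (by omega)
    have hik : (i : ℕ) ≠ k := by omega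
    rcases h with rfl | rfl <;> simp [hxi, coordVec, hik]
  · intro y hy y' hy'
    have hrep : ∀ y ∈ l', ∃ x ∈ l, ∃ r : ℝ, 0 ≤ r ∧ r ≤ η ∧
        y = x + (t * η + r) • coordVec d k := fun y hy => by
      obtain ⟨x, hx, h⟩ := hl' y hy
      rcases h with rfl | rfl
      · exact ⟨x, hx, 0, le_rfl, hη, by simp⟩
      · exact ⟨x, hx, η, hη, le_rfl, by ring_nf⟩
    obtain ⟨x, hx, r, hr0, hr1, rfl⟩ := hrep y hy
    obtain ⟨x', hx', r', hr0', hr1', rfl⟩ := hrep y' hy'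
    have hd := hl.2 x hx x' hx'
    have hkη : 0 ≤ (k : ℝ) * η := by positivity
    rw [dist_pi_le_iff (by positivity)] at hd ⊢
    intro i
    have hi := hd i
    rw [Real.dist_eq, abs_le] at hi ⊢
    push_cast
    simp only [Pi.add_apply, Pi.smul_apply, coordVec, smul_eq_mul]
    split_ifs
    · constructor <;> linarith
    · constructor <;> linarith

lemma boxChain_mem_flatTuples {η : ℝ} (hη : 0 ≤ η) (N k : ℕ) :
    boxChain d η N k ∈ chainsOn (flatTuples d η k) := by
  induction k with
  | zero => exact tuple_mem_chainsOn ⟨by simp, by simp⟩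
  | succ k ih =>
    have h := halfBoxChain_mem_flatTuples_of hη ih
    rw [boxChain_succ]
    exact add_mem h (push_mem_chainsOn _ (fun _ => map_neg_mem_flatTuples) h)

lemma halfBoxChain_mem_flatTuples {η : ℝ} (hη : 0 ≤ η) (N k : ℕ) :
    halfBoxChain d η N k ∈ chainsOn (flatTuples d η (k + 1)) :=
  halfBoxChain_mem_flatTuples_of hη (boxChain_mem_flatTuples hη N k)

lemma bd_halfBoxChain_add_mem_of {η : ℝ} (hη : 0 ≤ η) {N k : ℕ} (hk : k < d)
    (h : bd (boxChain d η N k) ∈ chainsOn (outerTuples d (N * η) k)) :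
    bd (halfBoxChain d η N k) + boxChain d η N k ∈
      chainsOn (outerTuples d (N * η) (k + 1)) := by
  have hNη : 0 ≤ (N : ℝ) * η := by positivity
  have heq : bd (halfBoxChain d η N k) + boxChain d η N k =
      push (· + ((N : ℝ) * η) • coordVec d k) (boxChain d η N k) +
        cylinder η (coordVec d k) N (bd (boxChain d η N k)) := by
    rw [halfBoxChain, bd_cylinder]
    have h := add_self_eq_zero_of_zmod_two (boxChain d η N k)
    rw [← sub_eq_zero]
    refine Eq.trans ?_ h
    abel
  rw [heq]
  refine add_mem (push_mem_chainsOn _ (fun l hl => ?_) (boxChain_mem_flatTuples hη N k))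
    (cylinder_mem_chainsOn _ _ _ (fun l hl t l' hl' y hy => ?_) h)
  · change ∀ x ∈ l.map _, _
    rw [List.forall_mem_map]
    intro x hx
    refine ⟨⟨k, hk⟩, Nat.lt_succ_self k, ?_⟩
    simp [coordVec, hl.1 x hx ⟨k, hk⟩ le_rfl, abs_mul, abs_of_nonneg hη]
  · obtain ⟨x, hx, h⟩ := hl' y hy
    obtain ⟨i, hi, hR⟩ := hl x hx
    have hik : (i : ℕ) ≠ k := by omega
    refine ⟨i, by omega, ?_⟩
    rcases h with rfl | rfl <;> simpa [coordVec, hik] using hR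

lemma bd_boxChain_mem {η : ℝ} (hη : 0 ≤ η) {N k : ℕ} (hk : k ≤ d) :
    bd (boxChain d η N k) ∈ chainsOn (outerTuples d (N * η) k) := by
  induction k with
  | zero =>
    rw [boxChain, bd_cons_tuple, bd_nil, map_zero, add_zero]
    exact tuple_mem_chainsOn (by simp [outerTuples])
  | succ k ih =>
    have h := bd_halfBoxChain_add_mem_of hη hk (ih (by omega))
    have heq : bd (boxChain d η N (k + 1)) =
        (bd (halfBoxChain d η N k) + boxChain d η N k) +
          push Neg.neg (bd (halfBoxChain d η N k) + boxChain d η N k) := by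
      rw [boxChain_succ, map_add, bd_push, map_add, push_neg_boxChain]
      have h := add_self_eq_zero_of_zmod_two (boxChain d η N k)
      rw [← sub_eq_zero, ← neg_eq_zero]
      refine Eq.trans ?_ h
      abel
    rw [heq]
    exact add_mem h (push_mem_chainsOn _ (fun _ => map_neg_mem_outerTuples) h)

lemma bd_halfBoxChain_add_mem {η : ℝ} (hη : 0 ≤ η) {N k : ℕ} (hk : k < d) :
    bd (halfBoxChain d η N k) + boxChain d η N k ∈
      chainsOn (outerTuples d (N * η) (k + 1)) :=
  bd_halfBoxChain_add_mem_of hη hk (bd_boxChain_mem hη hk.le)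

/-- The approximate boundary of the upper half of the `(k + 1)`-dimensional slice of `U`. -/
def slice (U : Set (Fin d → ℝ)) (η : ℝ) (N k : ℕ) : Chain (Fin d → ℝ) :=
  bd (restr U (halfBoxChain d η N k)) + restr U (boxChain d η N k)

lemma slice_mem_nearTuples {U : Set (Fin d → ℝ)} {η ε : ℝ} (hη : 0 ≤ η) {N k : ℕ} (hk : k < d)
    (hU : ∀ x, ∀ i, N * η ≤ |x i| → x ∉ U) (hUne : ∃ y, y ∉ U) (hε : d * η ≤ ε) :
    slice U η N k ∈ chainsOn (nearTuples U ε) := by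
  obtain ⟨y, hy⟩ := hUne
  have h1 := bd_restr_add_restr_bd_mem (U := U) (ε := ε)
    (fun l hl x hx y hy => (hl.2 x hx y hy).trans
      (le_trans (mul_le_mul_of_nonneg_right (by exact_mod_cast hk) hη) hε))
    (halfBoxChain_mem_flatTuples (d := d) hη N k)
  have h2 := restr_mem_nearTuples (ε := ε) hy (fun l hl x hx => by
    obtain ⟨i, -, hi⟩ := hl x hx
    exact hU x i hi) (bd_halfBoxChain_add_mem (N := N) hη hk)
  have heq : slice U η N k = (bd (restr U (halfBoxChain d η N k)) +
      restr U (bd (halfBoxChain d η N k))) +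
      restr U (bd (halfBoxChain d η N k) + boxChain d η N k) := by
    rw [slice, map_add]
    have h := add_self_eq_zero_of_zmod_two (restr U (bd (halfBoxChain d η N k)))
    rw [← sub_eq_zero, ← neg_eq_zero]
    refine Eq.trans ?_ h
    abel
  rw [heq]
  exact add_mem h1 h2

lemma extend_cup_slice {U : Set (Fin d → ℝ)} {η ε : ℝ} (hη : 0 ≤ η) {N : ℕ}
    (hU : ∀ x, ∀ i, N * η ≤ |x i| → x ∉ U) (hUne : ∃ y, y ∉ U) (hε : d * η ≤ ε)
    (h0 : 0 ∈ U) (hneg : ∀ x, -x ∈ U ↔ x ∈ U) {S : List ((Fin d → ℝ) → ZMod 2)}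
    (hS : ∀ s ∈ S, ∀ l ∈ nearTuples U ε, ∀ x ∈ l, s (-x) = s x + 1) (hd : S.length < d) :
    extend (cup S) (slice U η N S.length) = 1 := by
  induction S with
  | nil =>
    rw [slice, map_add, extend_cup_bd, zero_add, List.length_nil, boxChain,
      restr_tuple_of_forall (by simpa using h0), extend_tuple, cup_nil_singleton]
  | cons s S ih =>
    rw [List.length_cons] at hd ⊢
    rw [← ih (fun t ht => hS t (List.mem_cons_of_mem _ ht)) (by omega)]
    exact extend_cup_cons_eq hneg (hS s List.mem_cons_self)
      (fun l hl t ht => hS t (List.mem_cons_of_mem _ ht) l hl)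
      (push_neg_boxChain η N S.length) (boxChain_succ η N S.length)
      (slice_mem_nearTuples hη (by omega) hU hUne hε)

end Box

open Classical in
/-- The sign of `f`, the ties being broken by the lexicographic order. -/
def signLabel {d : ℕ} (f : (Fin d → ℝ) → ℝ) (x : Fin d → ℝ) : ZMod 2 :=
  if 0 < f x ∨ (f x = 0 ∧ toLex x < toLex (-x)) then 1 else 0

lemma signLabel_neg {d : ℕ} {f : (Fin d → ℝ) → ℝ} (hf : ∀ x, f (-x) = -f x)
    {x : Fin d → ℝ} (hx : x ≠ 0) : signLabel f (-x) = signLabel f x + 1 := by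
  classical
  have hne : toLex x ≠ toLex (-x) := fun h => by
    have h' : x = -x := toLex.injective h
    exact hx (self_eq_neg.1 h')
  have h2 : (1 : ZMod 2) + 1 = 0 := by decide
  unfold signLabel
  rw [hf, neg_neg]
  rcases lt_trichotomy (f x) 0 with h | h | h
  · rw [if_pos (Or.inl (by linarith)), if_neg (by rintro (h' | ⟨h', -⟩) <;> linarith), zero_add]
  · rcases lt_or_gt_of_ne hne with h' | h'
    · rw [if_neg (by rintro (h'' | ⟨-, h''⟩); exacts [by linarith, h''.not_gt h']),
        if_pos (Or.inr ⟨h, h'⟩), h2]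
    · rw [if_pos (Or.inr ⟨by linarith, h'⟩),
        if_neg (by rintro (h'' | ⟨-, h''⟩); exacts [by linarith, h''.not_gt h']), zero_add]
  · rw [if_neg (by rintro (h' | ⟨h', -⟩) <;> linarith), if_pos (Or.inl h), h2]

lemma signLabel_of_pos {d : ℕ} {f : (Fin d → ℝ) → ℝ} {x : Fin d → ℝ} (h : 0 < f x) :
    signLabel f x = 1 := by
  classical
  exact if_pos (Or.inl h)

lemma signLabel_of_neg {d : ℕ} {f : (Fin d → ℝ) → ℝ} {x : Fin d → ℝ} (h : f x < 0) :
    signLabel f x = 0 := by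
  classical
  exact if_neg (by rintro (h' | ⟨h', -⟩) <;> linarith)


/-- A form of the Borsuk–Ulam theorem: if `ψ` is even, negative at the origin and nonnegative
outside a box, then any `n` odd functions on `ℝⁿ⁺¹` have a common zero on `{ψ = 0}`. -/
theorem exists_zero_of_odd_of_even {n : ℕ} {φ : (Fin (n + 1) → ℝ) → Fin n → ℝ}
    (hφ : Continuous φ) (hφodd : ∀ x, φ (-x) = -φ x) {ψ : (Fin (n + 1) → ℝ) → ℝ}
    (hψ : Continuous ψ) (hψeven : ∀ x, ψ (-x) = ψ x) (hψ0 : ψ 0 < 0) {R : ℝ}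
    (hR : ∀ x, ∀ i, R ≤ |x i| → 0 ≤ ψ x) : ∃ x, ψ x = 0 ∧ φ x = 0 := by
  by_contra! hne
  have hRpos : 0 < R := by
    by_contra! h
    exact (hR 0 0 (by simpa using h)).not_gt hψ0
  set U : Set (Fin (n + 1) → ℝ) := {x | ψ x < 0} with hUdef
  set K : Set (Fin (n + 1) → ℝ) := Metric.closedBall 0 (R + 1) with hKdef
  have hK : IsCompact K := isCompact_closedBall 0 (R + 1)
  have h0K : (0 : Fin (n + 1) → ℝ) ∈ K := by simp [hKdef]; linarith
  set Φ : (Fin (n + 1) → ℝ) → ℝ × (Fin n → ℝ) := fun x => (ψ x, φ x) with hΦdef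
  have hΦ : Continuous Φ := hψ.prodMk hφ
  obtain ⟨x₀, hx₀K, hx₀⟩ := hK.exists_isMinOn ⟨0, h0K⟩ hΦ.norm.continuousOn
  set δ := ‖Φ x₀‖ with hδdef
  have hδ : 0 < δ := by
    refine norm_pos_iff.2 fun h => ?_
    have h' := Prod.mk_eq_zero.1 h
    exact hne x₀ h'.1 h'.2
  have hmin : ∀ x ∈ K, δ ≤ ‖Φ x‖ := fun x hx => hx₀ hx
  obtain ⟨ε, hε, hunif⟩ := Metric.uniformContinuousOn_iff.1
    (hK.uniformContinuousOn_of_continuous hΦ.continuousOn) (δ / 2) (by linarith)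
  set ε' := min ε 1 / 2 with hε'def
  have hε' : 0 < ε' := by positivity
  have hε'ε : ε' < ε := by
    have := min_le_left ε 1
    linarith
  have hε'1 : ε' ≤ 1 := by
    have := min_le_right ε 1
    linarith
  set η := ε' / ((n + 1 : ℕ) : ℝ) with hηdef
  have hη : 0 < η := by positivity
  obtain ⟨N, hN⟩ := exists_nat_ge (R / η)
  have hNR : R ≤ N * η := (div_le_iff₀ hη).1 hN
  have hUK : ∀ x ∈ U, ‖x‖ ≤ R := fun x hx => by
    rw [pi_norm_le_iff_of_nonneg hRpos.le]
    intro i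
    by_contra! h
    exact (hR x i h.le).not_gt hx
  have hnear : ∀ l ∈ nearTuples U ε', ∀ x ∈ l, ∃ y ∈ K, ∃ j,
      δ ≤ |φ y j| ∧ ∀ z ∈ l, |φ z j - φ y j| < δ / 2 := by
    rintro l ⟨hlU, y, hyU, hy⟩ x hx
    have hlK : ∀ z ∈ l, z ∈ K := fun z hz => by
      have := hUK z (hlU z hz)
      rw [hKdef, mem_closedBall_zero_iff]
      linarith
    have hyK : y ∈ K := by
      rw [hKdef, mem_closedBall_zero_iff]
      have h1 := hUK x (hlU x hx)
      have h2 := hy x hx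
      rw [dist_comm, dist_eq_norm] at h2
      have h3 := norm_add_le (y - x) x
      rw [sub_add_cancel] at h3
      linarith
    have hdist : ∀ z ∈ l, dist (ψ z) (ψ y) < δ / 2 ∧ dist (φ z) (φ y) < δ / 2 := fun z hz => by
      have := hunif z (hlK z hz) y hyK ((hy z hz).trans_lt hε'ε)
      rwa [Prod.dist_eq, max_lt_iff] at this
    have hψy : |ψ y| < δ := by
      have h1 := (hdist x hx).1
      have h2 : ψ x < 0 := hlU x hx
      have h3 : 0 ≤ ψ y := not_lt.1 hyU
      rw [Real.dist_eq, abs_lt] at h1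
      rw [abs_of_nonneg h3]
      linarith
    have hφy : δ ≤ ‖φ y‖ := by
      have h1 := hmin y hyK
      rw [Prod.norm_mk, le_max_iff, Real.norm_eq_abs] at h1
      exact h1.resolve_left hψy.not_ge
    obtain ⟨j, hj⟩ : ∃ j, δ ≤ |φ y j| := by
      by_contra! h
      exact ((pi_norm_lt_iff hδ).2 h).not_ge hφy
    refine ⟨y, hyK, j, hj, fun z hz => ?_⟩
    have := (dist_le_pi_dist (φ z) (φ y) j).trans_lt (hdist z hz).2
    rwa [Real.dist_eq] at this
  set S : List ((Fin (n + 1) → ℝ) → ZMod 2) :=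
    List.ofFn fun j => signLabel fun x => φ x j with hSdef
  have hSlen : S.length = n := by simp [hSdef]
  have hodd : ∀ j x, φ (-x) j = -φ x j := fun j x => by rw [hφodd, Pi.neg_apply]
  have hφ0 : φ 0 = 0 := by
    have := hφodd 0
    rw [neg_zero] at this
    exact self_eq_neg.1 this
  have hS : ∀ s ∈ S, ∀ l ∈ nearTuples U ε', ∀ x ∈ l, s (-x) = s x + 1 := by
    intro s hs l hl x hx
    obtain ⟨j, rfl⟩ := (List.mem_ofFn' _ _).1 hs
    refine signLabel_neg (hodd j) ?_
    rintro rfl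
    obtain ⟨y, -, i, hi, hi'⟩ := hnear l hl 0 hx
    have := hi' 0 hx
    rw [hφ0, Pi.zero_apply, zero_sub, abs_neg] at this
    linarith
  have hbox : ∀ x, ∀ i, N * η ≤ |x i| → x ∉ U := fun x i h => not_lt.2 (hR x i (hNR.trans h))
  have hUne : ∃ y, y ∉ U := ⟨fun _ => N * η, hbox _ 0 (le_abs_self _)⟩
  have hηε : ((n + 1 : ℕ) : ℝ) * η ≤ ε' := by
    rw [hηdef]
    field_simp
    exact le_rfl
  have hneg : ∀ x, -x ∈ U ↔ x ∈ U := fun x => by simp [hUdef, hψeven]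
  have hone := extend_cup_slice hη.le hbox hUne hηε hψ0 hneg hS (by omega)
  have hzero : extend (cup S) (slice U η N S.length) =
      (0 : Chain (Fin (n + 1) → ℝ) →ₗ[ZMod 2] ZMod 2) (slice U η N S.length) := by
    refine map_eq_map_of_mem_chainsOn _ _ (fun l hl => ?_)
      (slice_mem_nearTuples hη.le (by omega) hbox hUne hηε)
    rw [extend_tuple, LinearMap.zero_apply]
    match l, hl with
    | [], _ => exact cup_nil S
    | x :: l, hl =>
      obtain ⟨y, -, j, hj, hj'⟩ := hnear _ hl x List.mem_cons_self
      have hmem : (signLabel fun x => φ x j) ∈ S := (List.mem_ofFn' _ _).2 ⟨j, rfl⟩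
      refine cup_eq_zero hmem fun a ha b hb => ?_
      have h1 := abs_lt.1 (hj' a ha)
      have h2 := abs_lt.1 (hj' b hb)
      rcases le_abs.1 hj with h | h
      · rw [signLabel_of_pos (by linarith), signLabel_of_pos (by linarith)]
      · rw [signLabel_of_neg (by linarith), signLabel_of_neg (by linarith)]
  rw [hone, LinearMap.zero_apply] at hzero
  exact one_ne_zero hzero

end

end BorsukChain

section Energy

variable {H F : Type*} [NormedAddCommGroup H] [InnerProductSpace ℝ H]
  [NormedAddCommGroup F] [NormedSpace ℝ F]

/-- The functional `u ↦ B(u, u) / 2 - ‖T u‖ ^ p / p`. -/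
noncomputable def energy (B : H →L[ℝ] H →L[ℝ] ℝ) (T : H →L[ℝ] F) (p : ℝ) (u : H) : ℝ :=
  (1 / 2) * B u u - (1 / p) * ‖T u‖ ^ p

lemma continuous_energy (B : H →L[ℝ] H →L[ℝ] ℝ) (T : H →L[ℝ] F) {p : ℝ} (hp : 2 < p) :
    Continuous (energy B T p) := by
  have h1 : Continuous fun u => B u u := by fun_prop
  have h2 : Continuous fun u => ‖T u‖ ^ p :=
    T.continuous.norm.rpow_const fun _ => Or.inr (by linarith)
  exact (h1.const_mul _).sub (h2.const_mul _)

lemma rpow_eq_rpow_sub_two_mul_sq {x : ℝ} (hx : 0 ≤ x) {p : ℝ} (hp : 2 < p) :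
    x ^ p = x ^ (p - 2) * x ^ 2 := by
  rw [← Real.rpow_natCast x 2, ← Real.rpow_add_of_nonneg hx (by linarith) (by norm_num)]
  norm_num

lemma exists_pos_rpow_eq {r a : ℝ} (hr : 0 < r) (ha : 0 < a) : ∃ t : ℝ, 0 < t ∧ t ^ r = a :=
  ⟨a ^ r⁻¹, Real.rpow_pos_of_pos ha _, Real.rpow_inv_rpow ha.le hr.ne'⟩

/-- Every vector can be rescaled to a zero of the energy. -/
lemma exists_smul_energy_eq_zero {B : H →L[ℝ] H →L[ℝ] ℝ} {T : H →L[ℝ] F} {p : ℝ} (hp : 2 < p)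
    {u : H} (hB : 0 < B u u) (hT : T u ≠ 0) : ∃ t : ℝ, 0 < t ∧
      t ^ (p - 2) * ((1 / p) * ‖T u‖ ^ p) = (1 / 2) * B u u ∧ energy B T p (t • u) = 0 := by
  have hg : 0 < (1 / p) * ‖T u‖ ^ p := by
    have := Real.rpow_pos_of_pos (norm_pos_iff.2 hT) p
    positivity
  obtain ⟨t, ht, h⟩ := exists_pos_rpow_eq (r := p - 2) (by linarith)
    (div_pos (show 0 < (1 / 2) * B u u by linarith) hg)
  have heq : t ^ (p - 2) * ((1 / p) * ‖T u‖ ^ p) = (1 / 2) * B u u := by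
    rw [h, div_mul_cancel₀ _ hg.ne']
  refine ⟨t, ht, heq, ?_⟩
  have hnorm : ‖T (t • u)‖ ^ p = t ^ (p - 2) * t ^ 2 * ‖T u‖ ^ p := by
    rw [map_smul, norm_smul, Real.norm_of_nonneg ht.le,
      Real.mul_rpow ht.le (norm_nonneg _), rpow_eq_rpow_sub_two_mul_sq ht.le hp]
  rw [energy, hnorm]
  simp only [map_smul, _root_.smul_apply, smul_eq_mul]
  linear_combination -t ^ 2 * heq

/-- Nonzero zeros of the energy are large where `T` is small. -/
lemma le_norm_of_energy_eq_zero {B : H →L[ℝ] H →L[ℝ] ℝ} {T : H →L[ℝ] F} {p c₀ : ℝ} (hp : 2 < p)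
    (hB : ∀ u, c₀ * ‖u‖ ^ 2 ≤ B u u) {τ M : ℝ} (hτ : 0 < τ)
    (h : M ^ (p - 2) * (τ ^ p * (2 / p)) = c₀) {u : H} (hu : u ≠ 0)
    (hT : ‖T u‖ ≤ τ * ‖u‖) (hE : energy B T p u = 0) : M ≤ ‖u‖ := by
  by_contra! hlt
  have hu' := norm_pos_iff.2 hu
  have h1 : ‖T u‖ ^ p ≤ τ ^ p * (‖u‖ ^ (p - 2) * ‖u‖ ^ 2) := by
    rw [← rpow_eq_rpow_sub_two_mul_sq hu'.le hp, ← Real.mul_rpow hτ.le hu'.le]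
    exact Real.rpow_le_rpow (norm_nonneg _) hT (by linarith)
  have h2 : ‖u‖ ^ (p - 2) < M ^ (p - 2) := Real.rpow_lt_rpow hu'.le hlt (by linarith)
  have h3 : 0 < τ ^ p * (2 / p) * ‖u‖ ^ 2 := by
    have := Real.rpow_pos_of_pos hτ p
    positivity
  have h4 : B u u = 2 / p * ‖T u‖ ^ p := by
    rw [energy] at hE
    linear_combination 2 * hE
  have h5 := hB u
  have h6 : 2 / p * ‖T u‖ ^ p ≤ 2 / p * (τ ^ p * (‖u‖ ^ (p - 2) * ‖u‖ ^ 2)) :=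
    mul_le_mul_of_nonneg_left h1 (by positivity)
  have h7 := mul_lt_mul_of_pos_right h2 h3
  rw [← h] at h5
  nlinarith

/-- If the zeros of the energy in a line are far away, then the nonlinear term is small near the
origin. -/
lemma norm_rpow_mul_le_of_forall_energy {B : H →L[ℝ] H →L[ℝ] ℝ} {T : H →L[ℝ] F} {p c₀ a : ℝ}
    (hp : 2 < p) (hc₀ : 0 < c₀) (hB : ∀ u, c₀ * ‖u‖ ^ 2 ≤ B u u)
    (ha : ∀ u, B u u ≤ (a * ‖u‖) ^ 2) {D s : ℝ} (hs : 0 < s) {w : H} (hw : s * a * ‖w‖ ≤ D)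
    (ha0 : 0 < a)
    (hD : ∀ t : ℝ, 0 < t → energy B T p (t • w) = 0 → w ≠ 0 → D ^ 2 ≤ B (t • w) (t • w)) :
    s ^ (p - 2) * ((1 / p) * ‖T w‖ ^ p) ≤ (1 / 2) * (a * ‖w‖) ^ 2 := by
  by_cases hT : T w = 0
  · rw [hT, norm_zero, Real.zero_rpow (by linarith), mul_zero, mul_zero]
    positivity
  · have hw0 : w ≠ 0 := by
      rintro rfl
      simp at hT
    have hwn := norm_pos_iff.2 hw0
    have hBw : 0 < B w w := lt_of_lt_of_le (by positivity) (hB w)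
    obtain ⟨t, ht, heq, hE⟩ := exists_smul_energy_eq_zero (B := B) hp hBw hT
    have h1 := hD t ht hE hw0
    simp only [map_smul, _root_.smul_apply, smul_eq_mul] at h1
    have h2 : (s * (a * ‖w‖)) ^ 2 ≤ (t * (a * ‖w‖)) ^ 2 := by
      have h3 : (s * (a * ‖w‖)) ^ 2 ≤ D ^ 2 :=
        pow_le_pow_left₀ (by positivity) (by rwa [← mul_assoc]) 2
      have h4 := mul_le_mul_of_nonneg_left (ha w) (sq_nonneg t)
      nlinarith
    have hst : s ≤ t := by
      have := (pow_le_pow_iff_left₀ (by positivity) (by positivity) two_ne_zero).1 h2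
      exact le_of_mul_le_mul_right this (by positivity)
    have hpow : s ^ (p - 2) ≤ t ^ (p - 2) := Real.rpow_le_rpow hs.le hst (by linarith)
    have hg : 0 ≤ (1 / p) * ‖T w‖ ^ p := by positivity
    calc _ ≤ t ^ (p - 2) * ((1 / p) * ‖T w‖ ^ p) := mul_le_mul_of_nonneg_right hpow hg
      _ = (1 / 2) * B w w := heq
      _ ≤ _ := by linarith [ha w]

lemma add_rpow_le_two_rpow_mul {x y p : ℝ} (hx : 0 ≤ x) (hy : 0 ≤ y) (hp : 0 ≤ p) :
    (x + y) ^ p ≤ 2 ^ p * (x ^ p + y ^ p) := by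
  have hxp := Real.rpow_nonneg hx p
  have hyp := Real.rpow_nonneg hy p
  have h2 : (0 : ℝ) ≤ 2 ^ p := by positivity
  rcases le_total x y with h | h
  · calc (x + y) ^ p ≤ (2 * y) ^ p := Real.rpow_le_rpow (by linarith) (by linarith) hp
      _ = 2 ^ p * y ^ p := Real.mul_rpow (by norm_num) hy
      _ ≤ _ := mul_le_mul_of_nonneg_left (by linarith) h2
  · calc (x + y) ^ p ≤ (2 * x) ^ p := Real.rpow_le_rpow (by linarith) (by linarith) hp
      _ = 2 ^ p * x ^ p := Real.mul_rpow (by norm_num) hx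
      _ ≤ _ := mul_le_mul_of_nonneg_left (by linarith) h2

/-- The homeomorphism acting as `ε` on `K` and as `ρ` on its orthogonal complement. -/
noncomputable def stretch (K : Submodule ℝ H) [K.HasOrthogonalProjection] {ε ρ : ℝ}
    (hε : ε ≠ 0) (hρ : ρ ≠ 0) : H ≃ₜ H where
  toFun u := ε • K.starProjection u + ρ • (u - K.starProjection u)
  invFun u := ε⁻¹ • K.starProjection u + ρ⁻¹ • (u - K.starProjection u)
  left_inv u := by
    have h : K.starProjection (K.starProjection u) = K.starProjection u :=
      K.starProjection_eq_self_iff.2 (K.starProjection_apply_mem u)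
    simp [h, smul_smul, hε, hρ]
  right_inv u := by
    have h : K.starProjection (K.starProjection u) = K.starProjection u :=
      K.starProjection_eq_self_iff.2 (K.starProjection_apply_mem u)
    simp [h, smul_smul, hε, hρ]
  continuous_toFun := by fun_prop
  continuous_invFun := by fun_prop

lemma stretch_apply (K : Submodule ℝ H) [K.HasOrthogonalProjection] {ε ρ : ℝ}
    (hε : ε ≠ 0) (hρ : ρ ≠ 0) (u : H) : stretch K hε hρ u =
      ε • K.starProjection u + ρ • (u - K.starProjection u) := rfl

/-- If all nonzero zeros of the energy in `Kᗮ` satisfy `D² ≤ B(u, u)`, then some odd homeomorphism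
keeps the energy nonnegative on the unit ball and at least `c₀ / 4 * (D / (s * a))²` on the unit
sphere of `Kᗮ`. -/
lemma exists_homeomorph_le_energy (B : H →L[ℝ] H →L[ℝ] ℝ) (T : H →L[ℝ] F) {p c₀ a : ℝ}
    (hp : 2 < p) (hc₀ : 0 < c₀) (hB : ∀ u, c₀ * ‖u‖ ^ 2 ≤ B u u) (ha0 : 0 < a)
    (ha : ∀ u, B u u ≤ (a * ‖u‖) ^ 2) {s : ℝ} (hs : 0 < s)
    (hs' : s ^ (p - 2) * (c₀ / 4) = 2 ^ p * ((1 / 2) * a ^ 2))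
    (K : Submodule ℝ H) [K.HasOrthogonalProjection] {D : ℝ} (hD0 : 0 < D)
    (hD : ∀ u ∈ Kᗮ, u ≠ 0 → energy B T p u = 0 → D ^ 2 ≤ B u u) :
    ∃ h : H ≃ₜ H, (∀ u, h (-u) = -h u) ∧ (∀ u, ‖u‖ < 1 → 0 ≤ energy B T p (h u)) ∧
      ∀ u ∈ Kᗮ, ‖u‖ = 1 → c₀ / 4 * (D / (s * a)) ^ 2 ≤ energy B T p (h u) := by
  set ρ := D / (s * a) with hρdef
  have hρ : 0 < ρ := by positivity
  have hsp : 0 < s ^ (p - 2) := Real.rpow_pos_of_pos hs _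
  have h2p : (0 : ℝ) < 2 ^ p := by positivity
  obtain ⟨ε, hε, hε'⟩ := exists_pos_rpow_eq (r := p - 2) (by linarith)
    (show 0 < c₀ / 4 / (2 ^ p * ((1 / p) * (‖T‖ + 1) ^ p)) by positivity)
  have hTp : 0 < 2 ^ p * ((1 / p) * (‖T‖ + 1) ^ p) := by positivity
  have hε'' : ε ^ (p - 2) * (2 ^ p * ((1 / p) * (‖T‖ + 1) ^ p)) = c₀ / 4 := by
    rw [hε', div_mul_cancel₀ _ hTp.ne']
  have key : ∀ u, ‖u‖ ≤ 1 → c₀ / 4 * ‖stretch K hε.ne' hρ.ne' u‖ ^ 2 ≤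
      energy B T p (stretch K hε.ne' hρ.ne' u) := by
    intro u hu
    set z := ε • K.starProjection u with hz
    set w := ρ • (u - K.starProjection u) with hw
    have hv : stretch K hε.ne' hρ.ne' u = z + w := stretch_apply ..
    have hzK : z ∈ K := K.smul_mem _ (K.starProjection_apply_mem u)
    have hwK : w ∈ Kᗮ := Kᗮ.smul_mem _ (K.sub_starProjection_mem_orthogonal u)
    have hpyth : ‖z + w‖ ^ 2 = ‖z‖ ^ 2 + ‖w‖ ^ 2 := by
      have := norm_add_sq_eq_norm_sq_add_norm_sq_of_inner_eq_zero z w (hwK z hzK)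
      simpa [sq] using this
    have hpyth' : ‖u‖ ^ 2 = ‖K.starProjection u‖ ^ 2 + ‖u - K.starProjection u‖ ^ 2 := by
      have := norm_add_sq_eq_norm_sq_add_norm_sq_of_inner_eq_zero (𝕜 := ℝ) (K.starProjection u)
        (u - K.starProjection u)
        ((K.sub_starProjection_mem_orthogonal u) _ (K.starProjection_apply_mem u))
      simpa [sq] using this
    have hu2 : ‖u‖ ^ 2 ≤ 1 := pow_le_one₀ (norm_nonneg _) hu
    have hzn : ‖z‖ ≤ ε := by
      have : ‖K.starProjection u‖ ≤ 1 := by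
        rw [← sq_le_one_iff₀ (norm_nonneg _)]
        nlinarith [sq_nonneg ‖u - K.starProjection u‖]
      rw [hz, norm_smul, Real.norm_of_nonneg hε.le]
      nlinarith
    have hwn : ‖w‖ ≤ ρ := by
      have : ‖u - K.starProjection u‖ ≤ 1 := by
        rw [← sq_le_one_iff₀ (norm_nonneg _)]
        nlinarith [sq_nonneg ‖K.starProjection u‖]
      rw [hw, norm_smul, Real.norm_of_nonneg hρ.le]
      nlinarith
    have hTw : 2 ^ p * ((1 / p) * ‖T w‖ ^ p) ≤ c₀ / 4 * ‖w‖ ^ 2 := by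
      have hwD : s * a * ‖w‖ ≤ D := by
        have : s * a * ρ = D := by
          rw [hρdef]
          field_simp
        rw [← this]
        exact mul_le_mul_of_nonneg_left hwn (by positivity)
      have h1 := norm_rpow_mul_le_of_forall_energy hp hc₀ hB ha hs hwD ha0
        fun t ht hE hw0 => hD _ (Kᗮ.smul_mem t hwK) (smul_ne_zero ht.ne' hw0) hE
      refine le_of_mul_le_mul_left ?_ hsp
      have h2 := mul_le_mul_of_nonneg_left h1 h2p.le
      have h3 : s ^ (p - 2) * (c₀ / 4 * ‖w‖ ^ 2) = 2 ^ p * ((1 / 2) * (a * ‖w‖) ^ 2) := by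
        linear_combination ‖w‖ ^ 2 * hs'
      linarith
    have hTz : 2 ^ p * ((1 / p) * ‖T z‖ ^ p) ≤ c₀ / 4 * ‖z‖ ^ 2 := by
      have h1 : ‖T z‖ ^ p ≤ (‖T‖ + 1) ^ p * (ε ^ (p - 2) * ‖z‖ ^ 2) := by
        calc ‖T z‖ ^ p ≤ ((‖T‖ + 1) * ‖z‖) ^ p := by
              refine Real.rpow_le_rpow (norm_nonneg _) ((T.le_opNorm z).trans ?_) (by linarith)
              exact mul_le_mul_of_nonneg_right (by linarith) (norm_nonneg _)
          _ = (‖T‖ + 1) ^ p * (‖z‖ ^ (p - 2) * ‖z‖ ^ 2) := by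
              rw [Real.mul_rpow (by positivity) (norm_nonneg _),
                ← rpow_eq_rpow_sub_two_mul_sq (norm_nonneg _) hp]
          _ ≤ _ := by
              have := Real.rpow_le_rpow (norm_nonneg _) hzn (by linarith : 0 ≤ p - 2)
              gcongr
      have h2 : 2 ^ p * ((1 / p) * ‖T z‖ ^ p) ≤
          2 ^ p * ((1 / p) * ((‖T‖ + 1) ^ p * (ε ^ (p - 2) * ‖z‖ ^ 2))) := by gcongr
      refine h2.trans_eq ?_
      linear_combination ‖z‖ ^ 2 * hε''
    have hTv : (1 / p) * ‖T (z + w)‖ ^ p ≤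
        2 ^ p * ((1 / p) * ‖T z‖ ^ p) + 2 ^ p * ((1 / p) * ‖T w‖ ^ p) := by
      have h1 : ‖T (z + w)‖ ^ p ≤ 2 ^ p * (‖T z‖ ^ p + ‖T w‖ ^ p) := by
        refine (Real.rpow_le_rpow (norm_nonneg _) ?_ (by linarith)).trans
          (add_rpow_le_two_rpow_mul (norm_nonneg _) (norm_nonneg _) (by linarith))
        rw [map_add]
        exact norm_add_le _ _
      have h2 := mul_le_mul_of_nonneg_left h1 (show (0 : ℝ) ≤ 1 / p by positivity)
      linarith
    have hBv := hB (z + w)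
    rw [hv, energy]
    rw [hpyth] at hBv ⊢
    linarith
  refine ⟨stretch K hε.ne' hρ.ne', fun u => ?_, fun u hu => ?_, fun u hu hu1 => ?_⟩
  · simp only [stretch_apply, map_neg]
    module
  · exact le_trans (by positivity) (key u hu.le)
  · have h0 : K.starProjection u = 0 := K.starProjection_apply_eq_zero_iff.2 hu
    have h1 := key u hu1.le
    have h2 : ‖stretch K hε.ne' hρ.ne' u‖ = ρ := by
      rw [stretch_apply, h0, smul_zero, zero_add, sub_zero, norm_smul, hu1, mul_one,
        Real.norm_of_nonneg hρ.le]
    rwa [h2] at h1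

end Energy


section HilbertBasis

variable {H F : Type*} [NormedAddCommGroup H] [InnerProductSpace ℝ H]
  [NormedAddCommGroup F] [NormedSpace ℝ F]

lemma mem_orthogonal_span_image_iff {ι : Type*} (v : ι → H) (s : Set ι) (u : H) :
    u ∈ (Submodule.span ℝ (v '' s))ᗮ ↔ ∀ i ∈ s, inner ℝ (v i) u = 0 := by
  refine ⟨fun h i hi => h _ (Submodule.subset_span ⟨i, hi, rfl⟩), fun h x hx => ?_⟩
  induction hx using Submodule.span_induction with
  | mem x hx =>
    obtain ⟨i, hi, rfl⟩ := hx
    exact h i hi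
  | zero => exact inner_zero_left _
  | add x y _ _ hx hy => rw [inner_add_left, hx, hy, add_zero]
  | smul a x _ hx => rw [inner_smul_left, hx, mul_zero]

/-- A compact operator is small on the orthogonal complement of the span of the first vectors of a
Hilbert basis. -/
lemma exists_norm_le_of_isCompactOperator [CompleteSpace H] (e : HilbertBasis ℕ ℝ H)
    (T : H →L[ℝ] F) (hT : IsCompactOperator T) {τ : ℝ} (hτ : 0 < τ) :
    ∃ m₀ : ℕ, ∀ m, m₀ ≤ m → ∀ u ∈ (Submodule.span ℝ (e '' {i : ℕ | i < m}))ᗮ,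
      ‖T u‖ ≤ τ * ‖u‖ := by
  by_contra! hcon
  have hunit : ∀ k : ℕ, ∃ v : H, ‖v‖ = 1 ∧ (∀ i < k, inner ℝ (e i) v = 0) ∧ τ ≤ ‖T v‖ := by
    intro k
    obtain ⟨m, hkm, u, hu, hlt⟩ := hcon k
    rw [mem_orthogonal_span_image_iff] at hu
    have hu0 : u ≠ 0 := by
      rintro rfl
      simp at hlt
    have hun := norm_pos_iff.2 hu0
    refine ⟨‖u‖⁻¹ • u, ?_, fun i hi => ?_, ?_⟩
    · rw [norm_smul, norm_inv, norm_norm, inv_mul_cancel₀ hun.ne']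
    · rw [inner_smul_right, hu i (show i < m by omega), mul_zero]
    · rw [map_smul, norm_smul, norm_inv, norm_norm, inv_mul_eq_div, le_div_iff₀ hun]
      exact hlt.le
  choose v hv1 hv2 hv3 using hunit
  obtain ⟨y, -, φ, hφ, hy⟩ := (hT.isCompact_closure_image_closedBall (f := (T : H →ₗ[ℝ] F))
    1).tendsto_subseq (x := fun k => T (v k)) fun k =>
      subset_closure ⟨v k, by simp [hv1 k], rfl⟩
  have hyτ : τ ≤ ‖y‖ := ge_of_tendsto' hy.norm fun k => hv3 _
  have hy0 : y ≠ 0 := norm_pos_iff.1 (hτ.trans_le hyτ)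
  obtain ⟨g, -, hg⟩ := exists_dual_vector ℝ y (norm_ne_zero_iff.2 hy0)
  set r : H := (InnerProductSpace.toDual ℝ H).symm (g.comp T) with hr
  have hrv : ∀ u, g (T u) = inner ℝ r u := fun u => by
    rw [hr, InnerProductSpace.toDual_symm_apply, ContinuousLinearMap.comp_apply]
  have hsum : Tendsto (fun k => ‖r - ∑ i ∈ Finset.range k, e.repr r i • e i‖) atTop (𝓝 0) := by
    have := ((e.hasSum_repr r).tendsto_sum_nat.const_sub r).norm
    simpa using this
  have hbound : ∀ k, ‖inner ℝ r (v k)‖ ≤ ‖r - ∑ i ∈ Finset.range k, e.repr r i • e i‖ := by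
    intro k
    have h0 : inner ℝ (∑ i ∈ Finset.range k, e.repr r i • e i) (v k) = 0 := by
      rw [sum_inner]
      refine Finset.sum_eq_zero fun i hi => ?_
      rw [inner_smul_left, hv2 k i (Finset.mem_range.1 hi), mul_zero]
    have h1 := norm_inner_le_norm (𝕜 := ℝ) (r - ∑ i ∈ Finset.range k, e.repr r i • e i) (v k)
    rwa [inner_sub_left, h0, sub_zero, hv1, mul_one] at h1
  have hlim : Tendsto (fun k => inner ℝ r (v (φ k))) atTop (𝓝 0) :=
    (squeeze_zero_norm hbound hsum).comp hφ.tendsto_atTop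
  have hlim' : Tendsto (fun k => inner ℝ r (v (φ k))) atTop (𝓝 (g y)) := by
    have := (g.continuous.tendsto y).comp hy
    refine this.congr fun k => ?_
    exact hrv _
  have hgy : g y = 0 := tendsto_nhds_unique hlim' hlim
  rw [hg] at hgy
  exact hy0 (norm_eq_zero.1 (by simpa using hgy))

/-- On a finite-dimensional space on which `T` is injective, the energy is bounded above, and it is
negative far away from the origin. -/
lemma exists_energy_le_of_finiteDimensional {W : Type*} [NormedAddCommGroup W] [NormedSpace ℝ W]
    [FiniteDimensional ℝ W] (B : H →L[ℝ] H →L[ℝ] ℝ) (T : H →L[ℝ] F) {p : ℝ} (hp : 2 < p)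
    (L : W →L[ℝ] H) (hL : Function.Injective L) (hT : Function.Injective T) :
    ∃ R C : ℝ, (∀ w, R ≤ ‖w‖ → energy B T p (L w) < 0) ∧ ∀ w, energy B T p (L w) ≤ C := by
  obtain ⟨κ, hκ, hanti⟩ := ((T.comp L : W →L[ℝ] F) : W →ₗ[ℝ] F).exists_antilipschitzWith
    (LinearMap.ker_eq_bot.2 (hT.comp hL))
  have hκ' : (0 : ℝ) < κ := by exact_mod_cast hκ
  have hTL : ∀ w, ‖w‖ ≤ κ * ‖T (L w)‖ := fun w => by
    have := hanti.le_mul_dist w 0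
    simpa using this
  set b := ‖B‖ * ‖L‖ ^ 2 with hb
  have hb0 : 0 ≤ b := by positivity
  have hBL : ∀ w, B (L w) (L w) ≤ b * ‖w‖ ^ 2 := fun w => by
    calc B (L w) (L w) ≤ ‖B (L w) (L w)‖ := le_abs_self _
      _ ≤ ‖B‖ * ‖L w‖ * ‖L w‖ := B.le_opNorm₂ _ _
      _ ≤ ‖B‖ * (‖L‖ * ‖w‖) * (‖L‖ * ‖w‖) := by
        have := L.le_opNorm w
        gcongr
      _ = b * ‖w‖ ^ 2 := by rw [hb]; ring
  have hκp : 0 < (κ : ℝ) ^ p := Real.rpow_pos_of_pos hκ' _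
  obtain ⟨R, hR, hR'⟩ := exists_pos_rpow_eq (r := p - 2) (a := p * (b + 1) / 2 * (κ : ℝ) ^ p)
    (by linarith) (by positivity)
  have hneg : ∀ w, R ≤ ‖w‖ → energy B T p (L w) < 0 := by
    intro w hw
    have hw0 : 0 < ‖w‖ := hR.trans_le hw
    have h1 : ‖w‖ ^ (p - 2) * ‖w‖ ^ 2 ≤ (κ : ℝ) ^ p * ‖T (L w)‖ ^ p := by
      rw [← rpow_eq_rpow_sub_two_mul_sq hw0.le hp, ← Real.mul_rpow hκ'.le (norm_nonneg _)]
      exact Real.rpow_le_rpow hw0.le (hTL w) (by linarith)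
    have h2 : R ^ (p - 2) ≤ ‖w‖ ^ (p - 2) := Real.rpow_le_rpow hR.le hw (by linarith)
    have h3 : p * (b + 1) / 2 * ‖w‖ ^ 2 ≤ ‖T (L w)‖ ^ p := by
      refine le_of_mul_le_mul_left ?_ hκp
      have h4 := mul_le_mul_of_nonneg_right h2 (sq_nonneg ‖w‖)
      rw [hR'] at h4
      linarith
    have h5 := mul_le_mul_of_nonneg_left h3 (show (0 : ℝ) ≤ 1 / p by positivity)
    have h6 : 1 / p * (p * (b + 1) / 2 * ‖w‖ ^ 2) = (b + 1) / 2 * ‖w‖ ^ 2 := by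
      field_simp
    have h7 := hBL w
    have h8 : 0 < ‖w‖ ^ 2 := by positivity
    rw [energy]
    linarith
  refine ⟨R, b * R ^ 2, hneg, fun w => ?_⟩
  rcases le_total R ‖w‖ with h | h
  · exact (hneg w h).le.trans (by positivity)
  · have h1 : ‖w‖ ^ 2 ≤ R ^ 2 := pow_le_pow_left₀ (norm_nonneg _) h 2
    have h2 := mul_le_mul_of_nonneg_left h1 hb0
    have h3 := hBL w
    have h4 : 0 ≤ (1 / p) * ‖T (L w)‖ ^ p := by positivity
    have h5 : 0 ≤ b * R ^ 2 := by positivity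
    rw [energy]
    linarith

/-- An odd homeomorphism keeping the energy nonnegative on the unit ball has an energy bounded
independently of the homeomorphism somewhere on the unit sphere of a subspace of given
codimension. -/
lemma exists_energy_le_of_homeomorph {e : ℕ → H} (he : Orthonormal ℝ e)
    (B : H →L[ℝ] H →L[ℝ] ℝ) (T : H →L[ℝ] F) (hT : Function.Injective T) {p : ℝ} (hp : 2 < p)
    (n : ℕ) : ∃ C : ℝ, ∀ h : H ≃ₜ H, (∀ u, h (-u) = -h u) →
      (∀ u, ‖u‖ < 1 → 0 ≤ energy B T p (h u)) →
      ∃ u, ‖u‖ = 1 ∧ (∀ i < n, inner ℝ (e i) u = 0) ∧ energy B T p (h u) ≤ C := by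
  set v : Fin (n + 1) → H := fun i => e i with hv
  have hvlin : LinearIndependent ℝ v := (he.comp _ Fin.val_injective).linearIndependent
  set L : (Fin (n + 1) → ℝ) →L[ℝ] H :=
    LinearMap.toContinuousLinearMap (Fintype.linearCombination ℝ v) with hLdef
  have hL : Function.Injective L := hvlin.fintypeLinearCombination_injective
  obtain ⟨R, C, hR, hC⟩ := exists_energy_le_of_finiteDimensional B T hp L hL hT
  refine ⟨C, fun h hodd hpos => ?_⟩
  have hodd' : ∀ x, h.symm (-x) = -h.symm x := fun x => by
    rw [Homeomorph.symm_apply_eq, hodd, Homeomorph.apply_symm_apply]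
  have h0 : h.symm 0 = 0 := by
    have := hodd' 0
    rw [neg_zero] at this
    have h2 : (2 : ℝ) • h.symm 0 = 0 := by
      rw [two_smul]
      exact eq_neg_iff_add_eq_zero.1 this
    exact (smul_eq_zero.1 h2).resolve_left two_ne_zero
  obtain ⟨x, hx1, hx2⟩ := BorsukChain.exists_zero_of_odd_of_even (n := n)
    (φ := fun x i => inner ℝ (e i) (h.symm (L x))) (ψ := fun x => ‖h.symm (L x)‖ - 1) (R := R)
    (continuous_pi fun i => continuous_const.inner (h.symm.continuous.comp L.continuous))
    (fun x => by
      ext i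
      simp only [map_neg, hodd', inner_neg_right, Pi.neg_apply])
    ((h.symm.continuous.comp L.continuous).norm.sub continuous_const)
    (fun x => by simp only [map_neg, hodd', norm_neg])
    (by simp [h0])
    (fun x i hx => by
      by_contra! hlt
      have h1 := hpos (h.symm (L x)) (by linarith)
      rw [Homeomorph.apply_symm_apply] at h1
      exact (hR x (hx.trans (norm_le_pi_norm x i))).not_ge h1)
  refine ⟨h.symm (L x), by linarith, fun i hi => congrFun hx2 ⟨i, hi⟩, ?_⟩
  rw [Homeomorph.apply_symm_apply]
  exact hC x

lemma energy_comp_nonneg_of_norm_le_one (B : H →L[ℝ] H →L[ℝ] ℝ) (T : H →L[ℝ] F) {p : ℝ}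
    (hp : 2 < p) {h : H → H} (hh : Continuous h)
    (hpos : ∀ u, ‖u‖ < 1 → 0 ≤ energy B T p (h u)) {u : H} (hu : ‖u‖ ≤ 1) :
    0 ≤ energy B T p (h u) := by
  have hclosed : IsClosed {u | 0 ≤ energy B T p (h u)} :=
    isClosed_le continuous_const ((continuous_energy B T hp).comp hh)
  have hsub : closure (Metric.ball (0 : H) 1) ⊆ {u | 0 ≤ energy B T p (h u)} :=
    hclosed.closure_subset_iff.2 fun u hu => hpos u (mem_ball_zero_iff.1 hu)
  rw [closure_ball _ one_ne_zero] at hsub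
  exact hsub (mem_closedBall_zero_iff.2 hu)

end HilbertBasis

lemma integral_abs_rpow_eq_norm_rpow {Ω : Type*} [MeasurableSpace Ω] {μ : Measure Ω} {p : ℝ}
    (hp : 0 < p) (f : Lp ℝ (ENNReal.ofReal p) μ) : ∫ x, |f x| ^ p ∂μ = ‖f‖ ^ p := by
  have hp0 : ENNReal.ofReal p ≠ 0 := by simpa using hp
  have h := MemLp.eLpNorm_eq_integral_rpow_norm hp0 ENNReal.ofReal_ne_top (Lp.memLp f)
  rw [ENNReal.toReal_ofReal hp.le] at h
  have hnonneg : 0 ≤ ∫ x, |f x| ^ p ∂μ := integral_nonneg fun x => by positivity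
  simp only [Real.norm_eq_abs] at h
  rw [Lp.norm_def, h, ENNReal.toReal_ofReal (by positivity), Real.rpow_inv_rpow hnonneg hp.ne']


/-- With `Γ*` the set of odd homeomorphisms `h : H → H` with `I(h(u)) ≥ 0`
on the open unit ball, and `c_m = sup_{h ∈ Γ*} inf{I(h(u)) : u ∈ E_{m-1}^⊥, ‖u‖ = 1}`, there
is `k > 0` with `c_{m+1} ≥ k d_m²` for every `m ≥ 1`; consequently `c_m → +∞`. -/
theorem minmax_levels_diverge
    {H : Type*} [NormedAddCommGroup H] [InnerProductSpace ℝ H] [CompleteSpace H]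
    {Ω : Type*} [MeasurableSpace Ω] (μ : Measure Ω)
    (q : ℝ) (hq : 1 < q) [Fact (1 ≤ ENNReal.ofReal (q + 1))]
    (T : H →L[ℝ] Lp ℝ (ENNReal.ofReal (q + 1)) μ)
    (hTcomp : IsCompactOperator T) (hTinj : Function.Injective T)
    (B : H →L[ℝ] H →L[ℝ] ℝ) (hBsymm : ∀ u v : H, B u v = B v u)
    (c0 : ℝ) (hc0 : 0 < c0) (hBcoer : ∀ u : H, c0 * ‖u‖ ^ 2 ≤ B u u)
    (I : H → ℝ)
    (hI : ∀ u : H, I u = (1 / 2) * B u u - (1 / (q + 1)) * ∫ x, |(T u) x| ^ (q + 1) ∂μ)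
    (N : Set H)
    (hN : N = {u : H | u ≠ 0 ∧
      (1 / 2) * B u u = (1 / (q + 1)) * ∫ x, |(T u) x| ^ (q + 1) ∂μ})
    (e : HilbertBasis ℕ ℝ H)
    (E : ℕ → Submodule ℝ H)
    (hE : ∀ m : ℕ, E m = Submodule.span ℝ (e '' {i : ℕ | i < m}))
    (d : ℕ → ℝ)
    (hd : ∀ m : ℕ, d m = sInf ((fun u => Real.sqrt (B u u)) '' (N ∩ ((E m)ᗮ : Set H))))
    (Γstar : Set (H ≃ₜ H))
    (hΓ : Γstar = {h : H ≃ₜ H | (∀ u : H, h (-u) = -(h u)) ∧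
      ∀ u : H, ‖u‖ < 1 → 0 ≤ I (h u)})
    (c : ℕ → ℝ)
    (hc : ∀ m : ℕ, 1 ≤ m → c m = sSup ((fun h : H ≃ₜ H =>
      sInf ((fun u => I (h u)) '' {u : H | u ∈ (E (m - 1))ᗮ ∧ ‖u‖ = 1})) '' Γstar)) :
    (∃ k > (0 : ℝ), ∀ m : ℕ, 1 ≤ m → k * (d m) ^ 2 ≤ c (m + 1)) ∧
    Tendsto c atTop atTop := by
  have hp : 2 < q + 1 := by linarith
  have hp0 : 0 < q + 1 := by linarith
  have hIe : I = energy B T (q + 1) := by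
    funext u
    rw [hI, energy, integral_abs_rpow_eq_norm_rpow hp0]
  have hNe : ∀ u, u ∈ N ↔ u ≠ 0 ∧ energy B T (q + 1) u = 0 := fun u => by
    rw [hN, Set.mem_ofPred_eq, integral_abs_rpow_eq_norm_rpow hp0, energy, sub_eq_zero]
  have hBpos : ∀ u : H, u ≠ 0 → 0 < B u u := fun u hu =>
    (mul_pos hc0 (pow_pos (norm_pos_iff.2 hu) 2)).trans_le (hBcoer u)
  have hmem : ∀ m u, u ∈ (E m)ᗮ ↔ ∀ i < m, inner ℝ (e i) u = 0 := fun m u => by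
    rw [hE, mem_orthogonal_span_image_iff]
    rfl
  have he1 : ∀ m, ‖e m‖ = 1 := e.orthonormal.norm_eq_one
  have heE : ∀ m, e m ∈ (E m)ᗮ := fun m =>
    (hmem m _).2 fun i hi => e.orthonormal.inner_eq_zero hi.ne
  have hfin : ∀ m, FiniteDimensional ℝ (E m) := fun m => by
    rw [hE]
    exact FiniteDimensional.span_of_finite ℝ ((Set.finite_lt_nat m).image e)
  have hne : ∀ m, (N ∩ ((E m)ᗮ : Set H)).Nonempty := fun m => by
    have hem : e m ≠ 0 := norm_ne_zero_iff.1 (by rw [he1]; exact one_ne_zero)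
    obtain ⟨t, ht, -, ht0⟩ := exists_smul_energy_eq_zero hp (hBpos _ hem)
      ((map_ne_zero_iff T hTinj).2 hem)
    exact ⟨t • e m, (hNe _).2 ⟨smul_ne_zero ht.ne' hem, ht0⟩, Submodule.smul_mem _ _ (heE m)⟩
  have hd_le : ∀ m, ∀ u ∈ (E m)ᗮ, u ≠ 0 → energy B T (q + 1) u = 0 → d m ≤ √(B u u) := by
    intro m u hu hu0 hE0
    rw [hd]
    refine csInf_le ⟨0, ?_⟩ ⟨u, ⟨(hNe u).2 ⟨hu0, hE0⟩, hu⟩, rfl⟩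
    rintro _ ⟨w, -, rfl⟩
    exact Real.sqrt_nonneg _
  have hle_d : ∀ m, ∀ τ M : ℝ, 0 < τ → 0 < M →
      M ^ (q + 1 - 2) * (τ ^ (q + 1) * (2 / (q + 1))) = c0 →
      (∀ u ∈ (E m)ᗮ, ‖T u‖ ≤ τ * ‖u‖) → √c0 * M ≤ d m := by
    intro m τ M hτ hM hτM hT
    rw [hd]
    refine le_csInf ((hne m).image _) ?_
    rintro _ ⟨u, ⟨huN, huE⟩, rfl⟩
    obtain ⟨hu0, hE0⟩ := (hNe u).1 huN
    have hMu := le_norm_of_energy_eq_zero hp hBcoer hτ hτM hu0 (hT u huE) hE0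
    refine Real.le_sqrt_of_sq_le ?_
    rw [mul_pow, Real.sq_sqrt hc0.le]
    exact (mul_le_mul_of_nonneg_left (pow_le_pow_left₀ hM.le hMu 2) hc0.le).trans (hBcoer u)
  have hd_pos : ∀ m, 0 < d m := by
    intro m
    obtain ⟨M, hM, hM'⟩ := exists_pos_rpow_eq (r := q + 1 - 2) (by linarith)
      (show 0 < c0 / ((‖T‖ + 1) ^ (q + 1) * (2 / (q + 1))) by positivity)
    refine (mul_pos (Real.sqrt_pos.2 hc0) hM).trans_le
      (hle_d m (‖T‖ + 1) M (by positivity) hM ?_ fun u _ => ?_)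
    · rw [hM']
      exact div_mul_cancel₀ _ (by positivity)
    · refine (T.le_opNorm u).trans ?_
      gcongr
      linarith
  have hd_top : Tendsto d atTop atTop := by
    refine tendsto_atTop.2 fun b => ?_
    set M := (|b| + 1) / √c0
    have hc0' := Real.sqrt_pos.2 hc0
    have hM : 0 < M := by positivity
    have hMp : 0 < M ^ (q + 1 - 2) * (2 / (q + 1)) := by positivity
    obtain ⟨τ, hτ, hτ'⟩ := exists_pos_rpow_eq (r := q + 1) hp0 (div_pos hc0 hMp)
    obtain ⟨m₀, hm₀⟩ := exists_norm_le_of_isCompactOperator e T hTcomp hτ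
    filter_upwards [eventually_ge_atTop m₀] with m hm
    refine le_trans ?_ (hle_d m τ M hτ hM ?_ fun u hu => hm₀ m hm u (by rwa [← hE]))
    · rw [mul_div_cancel₀ _ hc0'.ne']
      linarith [le_abs_self b]
    · rw [hτ']
      field_simp
  set a := ‖B‖ + 1
  have ha0 : 0 < a := by positivity
  have ha : ∀ u, B u u ≤ (a * ‖u‖) ^ 2 := fun u => by
    calc B u u ≤ ‖B u u‖ := le_abs_self _
      _ ≤ ‖B‖ * ‖u‖ * ‖u‖ := B.le_opNorm₂ _ _
      _ = ‖B‖ * ‖u‖ ^ 2 := by ring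
      _ ≤ a ^ 2 * ‖u‖ ^ 2 := by
        gcongr
        nlinarith [norm_nonneg B]
      _ = (a * ‖u‖) ^ 2 := by ring
  obtain ⟨s, hs, hs'⟩ := exists_pos_rpow_eq (r := q + 1 - 2) (by linarith)
    (show 0 < 2 ^ (q + 1) * ((1 / 2) * a ^ 2) / (c0 / 4) by positivity)
  have hnonneg : ∀ h ∈ Γstar, ∀ u, ‖u‖ = 1 → 0 ≤ I (h u) := fun h hh u hu => by
    rw [hΓ, Set.mem_ofPred_eq] at hh
    rw [hIe] at hh ⊢
    exact energy_comp_nonneg_of_norm_le_one B T hp h.continuous hh.2 hu.le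
  have hbdd : ∀ m, BddAbove ((fun h : H ≃ₜ H =>
      sInf ((fun u => I (h u)) '' {u : H | u ∈ (E m)ᗮ ∧ ‖u‖ = 1})) '' Γstar) := by
    intro m
    obtain ⟨C, hC⟩ := exists_energy_le_of_homeomorph e.orthonormal B T hTinj hp m
    refine ⟨C, ?_⟩
    rintro _ ⟨h, hh, rfl⟩
    have hh' := hh
    rw [hΓ, Set.mem_ofPred_eq, hIe] at hh'
    obtain ⟨u, hu1, huE, huC⟩ := hC h hh'.1 hh'.2
    refine le_trans (csInf_le (a := I (h u)) ⟨0, ?_⟩ ⟨u, ⟨(hmem m u).2 huE, hu1⟩, rfl⟩)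
      (by rwa [hIe])
    rintro _ ⟨w, hw, rfl⟩
    exact hnonneg h hh w hw.2
  have hk : 0 < c0 / 4 / (s * a) ^ 2 := by positivity
  have hmain : ∀ m, c0 / 4 / (s * a) ^ 2 * d m ^ 2 ≤ c (m + 1) := by
    intro m
    have := hfin m
    obtain ⟨h, hodd, hpos, hlow⟩ := exists_homeomorph_le_energy B T hp hc0 hBcoer ha0 ha hs
      (by rw [hs']; field_simp) (E m) (hd_pos m) fun u hu hu0 hE0 => by
        rw [← Real.sq_sqrt (hBpos u hu0).le]
        exact pow_le_pow_left₀ (hd_pos m).le (hd_le m u hu hu0 hE0) 2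
    rw [hc (m + 1) (by omega), Nat.add_sub_cancel]
    refine le_trans ?_ (le_csSup (hbdd m) ⟨h, by rw [hΓ, hIe]; exact ⟨hodd, hpos⟩, rfl⟩)
    refine le_csInf ⟨_, e m, ⟨heE m, he1 m⟩, rfl⟩ ?_
    rintro _ ⟨u, ⟨huE, hu1⟩, rfl⟩
    simp only [hIe]
    refine le_of_eq_of_le ?_ (hlow u huE hu1)
    rw [div_pow, mul_div_assoc', div_mul_eq_mul_div]
  refine ⟨⟨_, hk, fun m _ => hmain m⟩, (tendsto_add_atTop_iff_nat 1).1 ?_⟩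
  exact tendsto_atTop_mono hmain
    (((tendsto_pow_atTop two_ne_zero).comp hd_top).const_mul_atTop hk)
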